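/- Let N ≥ 2 be an integer, m > 1, δ > 0, R > 0, and let (u,v) be a regular radial solution of system (S_R) with p = q = m and μ = δ. Then u(r) = v(r) for all r ∈ [0,R]. -/

import Mathlib

/-- A regular radial solution of system (S_R) on the ball of radius `R`. -/
def IsRadialSolution (N : ℕ) (p q δ μ R : ℝ) (u v : ℝ → ℝ) : Prop :=
  ContDiffOn ℝ 1 u (Set.Icc 0 R) ∧ ContDiffOn ℝ 1 v (Set.Icc 0 R) ∧
  ContDiffOn ℝ 2 u (Set.Ioc 0 R) ∧ ContDiffOn ℝ 2 v (Set.Ioc 0 R) ∧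
  (∀ r ∈ Set.Ico (0:ℝ) R, 0 < u r) ∧ (∀ r ∈ Set.Ico (0:ℝ) R, 0 < v r) ∧
  deriv u 0 = 0 ∧ deriv v 0 = 0 ∧ u R = 0 ∧ v R = 0 ∧
  (∀ r ∈ Set.Ioc (0:ℝ) R,
    deriv (fun s => s ^ ((N:ℝ) - 1) * |deriv u s| ^ (p - 2) * deriv u s) r
      = -(r ^ ((N:ℝ) - 1) * v r ^ δ)) ∧
  (∀ r ∈ Set.Ioc (0:ℝ) R,
    deriv (fun s => s ^ ((N:ℝ) - 1) * |deriv v s| ^ (q - 2) * deriv v s) r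
      = -(r ^ ((N:ℝ) - 1) * u r ^ μ))

theorem abs_rpow_mul_self_of_nonneg {m x : ℝ} (hm : 1 < m) (hx : 0 ≤ x) :
    |x| ^ (m - 2) * x = x ^ (m - 1) := by
  rcases hx.eq_or_lt with rfl | hx
  · rw [mul_zero, Real.zero_rpow (by linarith)]
  · rw [abs_of_pos hx, ← Real.rpow_add_one hx.ne']
    congr 1
    ring

theorem monotone_abs_rpow_mul_self {m : ℝ} (hm : 1 < m) :
    Monotone fun x : ℝ => |x| ^ (m - 2) * x := by
  refine monotone_of_odd_of_monotoneOn_nonneg (fun x => by simp) fun x hx y hy hxy => ?_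
  simp only [abs_rpow_mul_self_of_nonneg hm hx, abs_rpow_mul_self_of_nonneg hm hy]
  exact Real.rpow_le_rpow hx hxy (by linarith)

theorem continuous_abs_rpow_mul_self {m : ℝ} (hm : 1 < m) :
    Continuous fun x : ℝ => |x| ^ (m - 2) * x := by
  have h : (fun x : ℝ => |x| ^ (m - 2) * x) =
      fun x => (max x 0) ^ (m - 1) - (max (-x) 0) ^ (m - 1) := by
    funext x
    have h0 : (0 : ℝ) ^ (m - 1) = 0 := Real.zero_rpow (by linarith)
    rcases le_total 0 x with hx | hx
    · rw [abs_rpow_mul_self_of_nonneg hm hx, max_eq_left hx, max_eq_right (by linarith), h0,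
        sub_zero]
    · have := abs_rpow_mul_self_of_nonneg hm (neg_nonneg.2 hx)
      rw [abs_neg] at this
      rw [max_eq_right hx, max_eq_left (by linarith), h0, ← this]
      ring
  rw [h]
  have hm' : 0 ≤ m - 1 := by linarith
  exact ((continuous_id.max continuous_const).rpow_const fun _ => Or.inr hm').sub
    ((continuous_neg.max continuous_const).rpow_const fun _ => Or.inr hm')

/-- Where the prescribed value of the derivative of the flux is nonzero, the flux is differentiable
and may be computed with one-sided derivatives at the ends of the interval. -/
theorem hasDerivAt_flux {n m R r c : ℝ} {u : ℝ → ℝ} (hr : r ∈ Set.Ioo 0 R) (hc : c ≠ 0)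
    (h : deriv (fun s => s ^ n * |deriv u s| ^ (m - 2) * deriv u s) r = c) :
    HasDerivAt (fun s => s ^ n * (|derivWithin u (Set.Icc 0 R) s| ^ (m - 2) *
      derivWithin u (Set.Icc 0 R) s)) c r := by
  have hd := (differentiableAt_of_deriv_ne_zero (h.symm ▸ hc)).hasDerivAt
  rw [h] at hd
  refine hd.congr_of_eventuallyEq ?_
  filter_upwards [isOpen_Ioo.mem_nhds hr] with s hs
  rw [derivWithin_of_mem_nhds (Icc_mem_nhds hs.1 hs.2), mul_assoc]

theorem ContDiffOn.hasDerivAt_derivWithin_Icc {u : ℝ → ℝ} {R r : ℝ}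
    (hu : ContDiffOn ℝ 1 u (Set.Icc 0 R)) (hr : r ∈ Set.Ioo 0 R) :
    HasDerivAt u (derivWithin u (Set.Icc 0 R) r) r :=
  ((hu.differentiableOn one_ne_zero) r (Set.Ioo_subset_Icc_self hr)).hasDerivWithinAt.hasDerivAt
    (Icc_mem_nhds hr.1 hr.2)

/-- Remark 3.1: for `p = q = m` and `μ = δ`, any regular radial solution of (S_R)
satisfies `u = v`. -/
theorem solution_symmetric (N : ℕ) (hN : 2 ≤ N) (m δ R : ℝ) (hm : 1 < m) (hδ : 0 < δ)
    (hR : 0 < R) (u v : ℝ → ℝ) (h : IsRadialSolution N m m δ δ R u v) :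
    ∀ r ∈ Set.Icc (0:ℝ) R, u r = v r := by
  obtain ⟨hu, hv, -, -, hu0, hv0, -, -, huR, hvR, hequ, heqv⟩ := h
  have hn : (0:ℝ) < (N:ℝ) - 1 := by
    have : (2:ℝ) ≤ N := by exact_mod_cast hN
    linarith
  set n : ℝ := (N:ℝ) - 1
  set φ : ℝ → ℝ := fun x => |x| ^ (m - 2) * x with hφ
  set u' := derivWithin u (Set.Icc 0 R) with hu'
  set v' := derivWithin v (Set.Icc 0 R) with hv'
  let G : ℝ → ℝ := fun r => (r ^ n * φ (u' r) - r ^ n * φ (v' r)) * (u r - v r)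
  have hG : ∀ r ∈ Set.Ioo 0 R, HasDerivAt G
      (r ^ n * ((u r ^ δ - v r ^ δ) * (u r - v r)) +
        r ^ n * ((φ (u' r) - φ (v' r)) * (u' r - v' r))) r := by
    intro r hr
    have hrn : 0 < r ^ n := Real.rpow_pos_of_pos hr.1 n
    have hur := Real.rpow_pos_of_pos (hu0 r ⟨hr.1.le, hr.2⟩) δ
    have hvr := Real.rpow_pos_of_pos (hv0 r ⟨hr.1.le, hr.2⟩) δ
    have h1 := hasDerivAt_flux hr (neg_ne_zero.2 (mul_pos hrn hvr).ne')
      (hequ r ⟨hr.1, hr.2.le⟩)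
    have h2 := hasDerivAt_flux hr (neg_ne_zero.2 (mul_pos hrn hur).ne')
      (heqv r ⟨hr.1, hr.2.le⟩)
    refine ((h1.sub h2).mul ((hu.hasDerivAt_derivWithin_Icc hr).sub
      (hv.hasDerivAt_derivWithin_Icc hr))).congr_deriv ?_
    simp only [hφ, hu', hv', Pi.sub_apply]
    ring
  have mul_sub_nonneg : ∀ {f : ℝ → ℝ} {s : Set ℝ}, MonotoneOn f s → ∀ a ∈ s, ∀ b ∈ s,
      0 ≤ (f a - f b) * (a - b) := by
    intro f s hf a ha b hb
    rcases le_total a b with hab | hab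
    · exact mul_nonneg_of_nonpos_of_nonpos (sub_nonpos.2 (hf ha hb hab)) (sub_nonpos.2 hab)
    · exact mul_nonneg (sub_nonneg.2 (hf hb ha hab)) (sub_nonneg.2 hab)
  have hsource : ∀ r ∈ Set.Ioo 0 R, 0 ≤ r ^ n * ((u r ^ δ - v r ^ δ) * (u r - v r)) :=
    fun r hr => mul_nonneg (Real.rpow_nonneg hr.1.le n)
      (mul_sub_nonneg (Real.monotoneOn_rpow_Ici_of_exponent_nonneg hδ.le)
        _ (hu0 r ⟨hr.1.le, hr.2⟩).le _ (hv0 r ⟨hr.1.le, hr.2⟩).le)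
  have hflux : ∀ r ∈ Set.Ioo 0 R, 0 ≤ r ^ n * ((φ (u' r) - φ (v' r)) * (u' r - v' r)) :=
    fun r hr => mul_nonneg (Real.rpow_nonneg hr.1.le n)
      (mul_sub_nonneg ((monotone_abs_rpow_mul_self hm).monotoneOn Set.univ)
        _ trivial _ trivial)
  have hφc : Continuous φ := continuous_abs_rpow_mul_self hm
  have hu'c : ContinuousOn u' (Set.Icc 0 R) :=
    hu.continuousOn_derivWithin (uniqueDiffOn_Icc hR) le_rfl
  have hv'c : ContinuousOn v' (Set.Icc 0 R) :=
    hv.continuousOn_derivWithin (uniqueDiffOn_Icc hR) le_rfl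
  have hpow : ContinuousOn (fun r : ℝ => r ^ n) (Set.Icc 0 R) :=
    (Real.continuous_rpow_const hn.le).continuousOn
  have hGc : ContinuousOn G (Set.Icc 0 R) :=
    ((hpow.mul (hφc.comp_continuousOn hu'c)).sub (hpow.mul (hφc.comp_continuousOn hv'c))).mul
      (hu.continuousOn.sub hv.continuousOn)
  have hGmono : MonotoneOn G (Set.Icc 0 R) := by
    refine monotoneOn_of_hasDerivWithinAt_nonneg (convex_Icc 0 R) hGc
      (fun r hr => (hG r (by simpa using hr)).hasDerivWithinAt) fun r hr => ?_
    rw [interior_Icc] at hr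
    exact add_nonneg (hsource r hr) (hflux r hr)
  have hG0 : G 0 = 0 := by simp [G, Real.zero_rpow hn.ne']
  have hGR : G R = 0 := by simp [G, huR, hvR]
  have hGzero : ∀ r ∈ Set.Icc 0 R, G r = 0 := fun r hr => le_antisymm
    (hGR ▸ hGmono hr (Set.right_mem_Icc.2 hR.le) hr.2)
    (hG0 ▸ hGmono (Set.left_mem_Icc.2 hR.le) hr hr.1)
  have heq : Set.EqOn u v (Set.Ioo 0 R) := by
    intro r hr
    have hd : HasDerivAt G 0 r := (hasDerivAt_const r (0:ℝ)).congr_of_eventuallyEq <| by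
      filter_upwards [Icc_mem_nhds hr.1 hr.2] with s hs using hGzero s hs
    have hsum := (hG r hr).unique hd
    have hz : r ^ n * ((u r ^ δ - v r ^ δ) * (u r - v r)) = 0 := by
      linarith [hsource r hr, hflux r hr]
    rcases mul_eq_zero.1 ((mul_eq_zero.1 hz).resolve_left
      (Real.rpow_pos_of_pos hr.1 n).ne') with hp | hp
    · exact (Real.rpow_left_inj (hu0 r ⟨hr.1.le, hr.2⟩).le (hv0 r ⟨hr.1.le, hr.2⟩).le
        hδ.ne').1 (sub_eq_zero.1 hp)
    · exact sub_eq_zero.1 hp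
  exact heq.of_subset_closure hu.continuousOn hv.continuousOn Set.Ioo_subset_Icc_self
    (closure_Ioo hR.ne).ge
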